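/- Let Φ be an m×N complex matrix with δ_{2s}(Φ) ≤ 0.1. Let r ∈ ℂ^N be 2s-sparse, let e ∈ ℂ^m, and set v = Φr + e and y = Φ*v. Then: (1) if ‖v‖₂ ≤ ε then ‖r‖₂ ≤ 1.06·(ε + ‖e‖₂); and (2) if ‖y‖_∞ ≤ η/√(2s) then ‖r‖_∞ ≤ 1.12·η + 1.17·‖e‖₂. -/

import Mathlib

open Matrix
open scoped BigOperators Classical

/-- The Euclidean (ℓ₂) norm of a finitely indexed complex vector. -/
noncomputable def l2 {ι : Type*} [Fintype ι] (x : ι → ℂ) : ℝ :=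
  Real.sqrt (∑ i, ‖x i‖ ^ 2)

/-- The ℓ₁ norm of a finitely indexed complex vector. -/
noncomputable def l1 {ι : Type*} [Fintype ι] (x : ι → ℂ) : ℝ := ∑ i, ‖x i‖

/-- The ℓ∞ (supremum) norm of a finitely indexed complex vector. -/
noncomputable def linf {ι : Type*} [Fintype ι] (x : ι → ℂ) : ℝ := ⨆ i, ‖x i‖

/-- The support of a vector, as a finite set of coordinates. -/
noncomputable def suppF {N : ℕ} (x : Fin N → ℂ) : Finset (Fin N) :=
  Finset.univ.filter fun i => x i ≠ 0

/-- A vector is `s`-sparse when it has at most `s` nonzero entries. -/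
def Sparse {N : ℕ} (s : ℕ) (x : Fin N → ℂ) : Prop := (suppF x).card ≤ s

/-- Restriction of a vector to a set `T` of coordinates: equal to `x` on `T`, zero off `T`. -/
noncomputable def restrictTo {N : ℕ} (x : Fin N → ℂ) (T : Finset (Fin N)) : Fin N → ℂ :=
  fun i => if i ∈ T then x i else 0

/-- `y` is a best `s`-sparse approximation of `x`: it agrees with `x` on a set of `s`
coordinates of largest magnitude and vanishes elsewhere. -/
def IsSparseApprox {N : ℕ} (s : ℕ) (x y : Fin N → ℂ) : Prop :=
  ∃ T : Finset (Fin N), T.card = min s N ∧ y = restrictTo x T ∧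
    ∀ i ∈ T, ∀ j ∉ T, ‖x j‖ ≤ ‖x i‖

/-- The `r`-th restricted isometry constant of `Φ`: the least `δ ≥ 0` such that
`(1-δ)‖x‖² ≤ ‖Φx‖² ≤ (1+δ)‖x‖²` for all `r`-sparse `x`. -/
noncomputable def RIC {m N : ℕ} (Φ : Matrix (Fin m) (Fin N) ℂ) (r : ℕ) : ℝ :=
  sInf {δ : ℝ | 0 ≤ δ ∧ ∀ x : Fin N → ℂ, Sparse r x →
    (1 - δ) * l2 x ^ 2 ≤ l2 (Φ.mulVec x) ^ 2 ∧ l2 (Φ.mulVec x) ^ 2 ≤ (1 + δ) * l2 x ^ 2}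

/-- The column submatrix of `Φ` with columns indexed by the finite set `T`. -/
noncomputable def colSub {m N : ℕ} (Φ : Matrix (Fin m) (Fin N) ℂ) (T : Finset (Fin N)) :
    Matrix (Fin m) {i // i ∈ T} ℂ :=
  Matrix.of fun r c => Φ r c.1

/-- The least-squares estimate `Φ_T† u = (Φ_T* Φ_T)⁻¹ Φ_T* u`, viewed as a vector in `ℂ^N`
supported on `T`. -/
noncomputable def pinvApply {m N : ℕ} (Φ : Matrix (Fin m) (Fin N) ℂ) (T : Finset (Fin N))
    (u : Fin m → ℂ) : Fin N → ℂ :=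
  fun j =>
    if h : j ∈ T then (((colSub Φ T)ᴴ * colSub Φ T)⁻¹ * (colSub Φ T)ᴴ).mulVec u ⟨j, h⟩
    else 0

/-- One iteration of CoSaMP with samples `u` and sparsity level `s`, mapping the current
approximation `a` to the next approximation `a'`. -/
def CoSaMPStep {m N : ℕ} (Φ : Matrix (Fin m) (Fin N) ℂ) (u : Fin m → ℂ) (s : ℕ)
    (a a' : Fin N → ℂ) : Prop :=
  ∃ y2s : Fin N → ℂ,
    IsSparseApprox (2 * s) (Φᴴ.mulVec (u - Φ.mulVec a)) y2s ∧
    IsSparseApprox s (pinvApply Φ (suppF y2s ∪ suppF a) u) a'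

/-- `a` is a sequence of approximations produced by CoSaMP: `a 0 = 0` and each successive
approximation arises from one CoSaMP iteration. -/
def CoSaMPSeq {m N : ℕ} (Φ : Matrix (Fin m) (Fin N) ℂ) (u : Fin m → ℂ) (s : ℕ)
    (a : ℕ → Fin N → ℂ) : Prop :=
  a 0 = 0 ∧ ∀ k, CoSaMPStep Φ u s (a k) (a (k + 1))

/-- The spectral norm (ℓ₂ → ℓ₂ operator norm) of a matrix. -/
noncomputable def specNorm {a b : Type*} [Fintype a] [Fintype b] (M : Matrix a b ℂ) : ℝ :=
  sSup ((fun x => l2 (M.mulVec x)) '' {x | l2 x ≤ 1})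

lemma l2_eq_norm {ι : Type*} [Fintype ι] (x : ι → ℂ) : l2 x = ‖WithLp.toLp 2 x‖ := by
  simp [l2, EuclideanSpace.norm_eq]

lemma l2_nonneg {ι : Type*} [Fintype ι] (x : ι → ℂ) : 0 ≤ l2 x := Real.sqrt_nonneg _

lemma l2_sq {ι : Type*} [Fintype ι] (x : ι → ℂ) : l2 x ^ 2 = ∑ i, ‖x i‖ ^ 2 :=
  Real.sq_sqrt (by positivity)

lemma l2_le_l2_add_add {ι : Type*} [Fintype ι] (x y : ι → ℂ) : l2 x ≤ l2 (x + y) + l2 y := by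
  simp only [l2_eq_norm, WithLp.toLp_add]
  exact norm_le_add_norm_add _ _

lemma norm_star_dotProduct_le {ι : Type*} [Fintype ι] (x y : ι → ℂ) :
    ‖star x ⬝ᵥ y‖ ≤ l2 x * l2 y := by
  have h := norm_inner_le_norm (𝕜 := ℂ) (WithLp.toLp 2 x) (WithLp.toLp 2 y)
  rwa [EuclideanSpace.inner_toLp_toLp, dotProduct_comm, ← l2_eq_norm, ← l2_eq_norm] at h

lemma star_dotProduct_self_eq_l2_sq {ι : Type*} [Fintype ι] (x : ι → ℂ) :
    star x ⬝ᵥ x = ((l2 x ^ 2 : ℝ) : ℂ) := by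
  simp [l2_sq, dotProduct, Complex.conj_mul']

lemma norm_apply_le_linf {ι : Type*} [Fintype ι] (x : ι → ℂ) (i : ι) : ‖x i‖ ≤ linf x :=
  le_ciSup (f := fun i => ‖x i‖) (Set.finite_range _).bddAbove i

lemma linf_nonneg {ι : Type*} [Fintype ι] (x : ι → ℂ) : 0 ≤ linf x :=
  Real.iSup_nonneg fun _ => norm_nonneg _

lemma linf_le_l2 {ι : Type*} [Fintype ι] (x : ι → ℂ) : linf x ≤ l2 x :=
  Real.iSup_le (fun i => Real.le_sqrt_of_sq_le
    (Finset.single_le_sum (f := fun i => ‖x i‖ ^ 2) (fun _ _ => by positivity)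
      (Finset.mem_univ i))) (l2_nonneg x)

lemma norm_star_dotProduct_le_l1_mul_linf {ι : Type*} [Fintype ι] (x y : ι → ℂ) :
    ‖star x ⬝ᵥ y‖ ≤ l1 x * linf y := by
  refine (norm_sum_le _ _).trans ?_
  rw [l1, Finset.sum_mul]
  refine Finset.sum_le_sum fun i _ => ?_
  rw [norm_mul, Pi.star_apply, norm_star]
  exact mul_le_mul_of_nonneg_left (norm_apply_le_linf y i) (norm_nonneg _)

lemma Sparse.l1_le {N k : ℕ} {x : Fin N → ℂ} (hx : Sparse k x) : l1 x ≤ √k * l2 x := by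
  have hsum : l1 x = ∑ i ∈ suppF x, ‖x i‖ := by
    rw [l1, suppF, Finset.sum_filter_of_ne]
    exact fun i _ hi => norm_ne_zero_iff.mp hi
  have hcard : ((suppF x).card : ℝ) ≤ k := by exact_mod_cast hx
  refine abs_le_of_sq_le_sq' ?_ (mul_nonneg (Real.sqrt_nonneg _) (l2_nonneg x)) |>.2
  rw [mul_pow, Real.sq_sqrt (Nat.cast_nonneg k), hsum, l2_sq]
  calc (∑ i ∈ suppF x, ‖x i‖) ^ 2 ≤ (suppF x).card * ∑ i ∈ suppF x, ‖x i‖ ^ 2 :=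
        sq_sum_le_card_mul_sum_sq
    _ ≤ k * ∑ i, ‖x i‖ ^ 2 := by
        gcongr
        exact Finset.subset_univ _

open scoped Matrix.Norms.L2Operator in
lemma exists_isRestrictedIsometryBound {m N : ℕ} (Φ : Matrix (Fin m) (Fin N) ℂ) (k : ℕ) :
    {δ : ℝ | 0 ≤ δ ∧ ∀ x : Fin N → ℂ, Sparse k x →
      (1 - δ) * l2 x ^ 2 ≤ l2 (Φ.mulVec x) ^ 2 ∧
        l2 (Φ.mulVec x) ^ 2 ≤ (1 + δ) * l2 x ^ 2}.Nonempty := by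
  refine ⟨1 + ‖Φ‖ ^ 2, by positivity, fun x _ => ⟨?_, ?_⟩⟩
  · nlinarith [mul_nonneg (sq_nonneg ‖Φ‖) (sq_nonneg (l2 x)), sq_nonneg (l2 (Φ.mulVec x))]
  · have h : l2 (Φ.mulVec x) ≤ ‖Φ‖ * l2 x := by
      rw [l2_eq_norm, l2_eq_norm]
      exact Matrix.l2_opNorm_mulVec Φ (WithLp.toLp 2 x)
    have h2 := pow_le_pow_left₀ (l2_nonneg _) h 2
    nlinarith [sq_nonneg (l2 x)]

/-- The restricted isometry constant satisfies its defining inequalities. -/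
lemma RIC_spec {m N k : ℕ} (Φ : Matrix (Fin m) (Fin N) ℂ) {x : Fin N → ℂ} (hx : Sparse k x) :
    (1 - RIC Φ k) * l2 x ^ 2 ≤ l2 (Φ.mulVec x) ^ 2 ∧
      l2 (Φ.mulVec x) ^ 2 ≤ (1 + RIC Φ k) * l2 x ^ 2 := by
  have hne := exists_isRestrictedIsometryBound Φ k
  rcases (sq_nonneg (l2 x)).eq_or_lt with h0 | hpos
  · obtain ⟨δ, -, hδ⟩ := hne
    simpa [← h0] using hδ x hx
  · have hlow : 1 - l2 (Φ.mulVec x) ^ 2 / l2 x ^ 2 ≤ RIC Φ k :=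
      le_csInf hne fun δ hδ => by
        linarith [(le_div_iff₀ hpos).mpr (hδ.2 x hx).1]
    have hupp : l2 (Φ.mulVec x) ^ 2 / l2 x ^ 2 - 1 ≤ RIC Φ k :=
      le_csInf hne fun δ hδ => by
        linarith [(div_le_iff₀ hpos).mpr (hδ.2 x hx).2]
    exact ⟨(le_div_iff₀ hpos).mp (by linarith), (div_le_iff₀ hpos).mp (by linarith)⟩

/-- The energy of `Φ r` is controlled by the correlations `Φ* (Φ r + e)` and the noise `e`. -/
lemma l2_mulVec_sq_le {m N : ℕ} (Φ : Matrix (Fin m) (Fin N) ℂ) (r : Fin N → ℂ) (e : Fin m → ℂ) :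
    l2 (Φ.mulVec r) ^ 2 ≤
      l1 r * linf (Φᴴ.mulVec (Φ.mulVec r + e)) + l2 (Φ.mulVec r) * l2 e := by
  have hid : ((l2 (Φ.mulVec r) ^ 2 : ℝ) : ℂ) =
      star r ⬝ᵥ Φᴴ.mulVec (Φ.mulVec r + e) - star (Φ.mulVec r) ⬝ᵥ e := by
    rw [dotProduct_mulVec, ← star_mulVec, dotProduct_add, star_dotProduct_self_eq_l2_sq,
      add_sub_cancel_right]
  calc l2 (Φ.mulVec r) ^ 2 = ‖((l2 (Φ.mulVec r) ^ 2 : ℝ) : ℂ)‖ := by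
        rw [Complex.norm_real, Real.norm_of_nonneg (sq_nonneg _)]
    _ ≤ ‖star r ⬝ᵥ Φᴴ.mulVec (Φ.mulVec r + e)‖ + ‖star (Φ.mulVec r) ⬝ᵥ e‖ := by
        rw [hid]
        exact norm_sub_le _ _
    _ ≤ _ := add_le_add (norm_star_dotProduct_le_l1_mul_linf _ _) (norm_star_dotProduct_le _ _)

/-- **Halting I.**  For a `2s`-sparse residual `r` with `v = Φr + e` and `y = Φ*v`:
if `‖v‖₂ ≤ ε` then `‖r‖₂ ≤ 1.06(ε + ‖e‖₂)`, and if `‖y‖_∞ ≤ η/√(2s)` then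
`‖r‖_∞ ≤ 1.12η + 1.17‖e‖₂`. -/
theorem halting_one
    {m N : ℕ} (s : ℕ) (hs : 0 < s) (Φ : Matrix (Fin m) (Fin N) ℂ)
    (hΦ : RIC Φ (2 * s) ≤ 0.1)
    (r : Fin N → ℂ) (hr : Sparse (2 * s) r) (e : Fin m → ℂ) (ε η : ℝ) :
    (l2 (Φ.mulVec r + e) ≤ ε → l2 r ≤ 1.06 * (ε + l2 e)) ∧
    (linf (Φᴴ.mulVec (Φ.mulVec r + e)) ≤ η / Real.sqrt (2 * s) →
      linf r ≤ 1.12 * η + 1.17 * l2 e) := by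
  obtain ⟨hlow, hupp⟩ := RIC_spec Φ hr
  have hr0 := l2_nonneg r
  have hΦr0 := l2_nonneg (Φ.mulVec r)
  have he0 := l2_nonneg e
  have hlow' : 0.9 * l2 r ^ 2 ≤ l2 (Φ.mulVec r) ^ 2 := by nlinarith [sq_nonneg (l2 r)]
  have hupp' : l2 (Φ.mulVec r) ≤ 1.05 * l2 r :=
    (abs_le_of_sq_le_sq' (by nlinarith [sq_nonneg (l2 r)]) (by positivity)).2
  refine ⟨fun hε => ?_, fun hη => ?_⟩
  · have hv := l2_le_l2_add_add (Φ.mulVec r) e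
    have hle : l2 r ≤ 1.06 * l2 (Φ.mulVec r) :=
      (abs_le_of_sq_le_sq' (by nlinarith) (by positivity)).2
    linarith
  · have hs0 : 0 < √(2 * (s : ℝ)) := by positivity
    have hl1 : l1 r ≤ √(2 * (s : ℝ)) * l2 r := by simpa using hr.l1_le
    have hη0 : 0 ≤ η := by
      by_contra! hneg
      exact ((linf_nonneg _).trans hη).not_gt (div_neg_of_neg_of_pos hneg hs0)
    have hcorr : l1 r * linf (Φᴴ.mulVec (Φ.mulVec r + e)) ≤ l2 r * η :=
      calc l1 r * linf (Φᴴ.mulVec (Φ.mulVec r + e))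
          ≤ √(2 * (s : ℝ)) * l2 r * (η / √(2 * (s : ℝ))) :=
            mul_le_mul hl1 hη (linf_nonneg _) (by positivity)
        _ = l2 r * η := by field_simp
    have hnoise := mul_le_mul_of_nonneg_right hupp' he0
    have henergy := l2_mulVec_sq_le Φ r e
    refine (linf_le_l2 r).trans ?_
    rcases hr0.eq_or_lt with h0 | hpos
    · rw [← h0]
      positivity
    · have hmul : l2 r * (0.9 * l2 r) ≤ l2 r * (η + 1.05 * l2 e) := by linarith
      linarith [le_of_mul_le_mul_left hmul hpos]
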